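/- Let W be a positive solution of the delay differential equation W'(x) = (W(x)²/(ℓ φ(W(x)))) · [φ(W(x)) − φ(W(x + ℓ/W(x)))] on an interval (−∞, x̂], and suppose there is a point x̃ < x̂ with W'(x̃) = 0 while W'(x) > 0 for all x with x̃ < x ≤ x̂ + ℓ/W(x̃). Then a contradiction follows; consequently a positive backward solution of the DDE with strictly increasing data ahead can have no critical point, i.e. it is strictly monotone increasing. -/

import Mathlib

/-- A positive solution of the profile DDE on `(−∞, x̂]` cannot have
a critical point `x̃ < x̂` with `W'(x̃) = 0` while `W' > 0` on
`(x̃, x̂ + ℓ/W(x̃)]`: such a configuration yields a contradiction, hence a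
positive backward solution with strictly increasing data ahead is strictly
monotone increasing. -/
theorem dde_no_critical_point
    (ℓ chat : ℝ) (hℓ : 0 < ℓ) (hchat : 0 < chat)
    (φ : ℝ → ℝ) (hφd : Differentiable ℝ φ)
    (hφ1 : φ 1 = 0) (hφ0 : φ 0 = 1)
    (hφ' : ∀ ρ ∈ Set.Icc (0:ℝ) 1, deriv φ ρ ≤ -chat)
    (xhat : ℝ) (W : ℝ → ℝ)
    (hWpos : ∀ x, 0 < W x) (hWle : ∀ x, W x ≤ 1)
    (hdde : ∀ x ≤ xhat, HasDerivAt W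
      (W x ^ 2 / (ℓ * φ (W x)) * (φ (W x) - φ (W (x + ℓ / W x)))) x)
    (xtil : ℝ) (hxtil : xtil < xhat)
    (hcrit : deriv W xtil = 0)
    (hpos : ∀ x, xtil < x → x ≤ xhat + ℓ / W xtil → 0 < deriv W x) :
    False := by
  have hd : 0 < ℓ / W xtil := div_pos hℓ (hWpos xtil)
  have hanti : StrictAntiOn φ (Set.Icc (0:ℝ) 1) := by
    apply strictAntiOn_of_deriv_neg (convex_Icc 0 1) hφd.continuous.continuousOn
    intro x hx
    have := hφ' x (interior_subset hx)
    linarith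
  have hmono : StrictMonoOn W (Set.Icc xtil (xhat + ℓ / W xtil)) := by
    apply strictMonoOn_of_deriv_pos (convex_Icc _ _)
    · intro x hx
      apply ContinuousAt.continuousWithinAt
      rcases hx.1.eq_or_lt with h | h
      · subst h
        exact (hdde _ hxtil.le).continuousAt
      · exact (differentiableAt_of_deriv_ne_zero (hpos x h hx.2).ne').continuousAt
    · intro x hx
      rw [interior_Icc] at hx
      exact hpos x hx.1 hx.2.le
  have hlt : W xtil < W (xtil + ℓ / W xtil) :=
    hmono ⟨le_rfl, by linarith⟩ ⟨by linarith, by linarith⟩ (by linarith)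
  have h1 : φ (W (xtil + ℓ / W xtil)) < φ (W xtil) :=
    hanti ⟨(hWpos _).le, hWle _⟩ ⟨(hWpos _).le, hWle _⟩ hlt
  have h2 : 0 < φ (W xtil) := by
    rw [← hφ1]
    exact hanti ⟨(hWpos _).le, hWle _⟩ ⟨zero_le_one, le_rfl⟩ (hlt.trans_le (hWle _))
  have h3 := (hdde xtil hxtil.le).deriv
  rw [hcrit] at h3
  have h4 : 0 < W xtil ^ 2 / (ℓ * φ (W xtil)) :=
    div_pos (pow_pos (hWpos _) 2) (mul_pos hℓ h2)
  have h5 := mul_pos h4 (sub_pos.mpr h1)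
  linarith
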